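/- arXiv:2604.18237 — 8 statements merged into one kernel-verified Lean document; each statement's English description precedes it below -/
import Mathlib

section
/- Let N ≥ 1 and for each i = 1, …, N let Z_i be a real d × m_i matrix with m_i a positive integer, let m = Σ_{i=1}^N m_i, and let ε > 0. Then (1/2)·log det( I_d + (d/(m ε²)) · Σ_{i=1}^N Z_i Z_iᵀ ) ≥ Σ_{i=1}^N (m_i/(2m)) · log det( I_d + (d/(m_i ε²)) · Z_i Z_iᵀ ), where I_d is the d × d identity matrix. (This is inequality (4) of the paper: Z Zᵀ = Σ_i Z_i Z_iᵀ for the horizontal concatenation Z = [Z_1, …, Z_N], so the coding rate R(Z, ε) = (1/2) log det(I + (d/(m ε²)) Z Zᵀ) dominates the weighted sum of the local coding rates.) -/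
open Matrix BigOperators

theorem Matrix.PosDef.log_det_le_trace_sub_card {n : Type*} [Fintype n] [DecidableEq n]
    {A : Matrix n n ℝ} (hA : A.PosDef) : Real.log A.det ≤ A.trace - Fintype.card n := by
  have hdet : A.det = ∏ i, hA.isHermitian.eigenvalues i := by
    simpa using hA.isHermitian.det_eq_prod_eigenvalues
  have htr : A.trace = ∑ i, hA.isHermitian.eigenvalues i := by
    simpa using hA.isHermitian.trace_eq_sum_eigenvalues
  rw [hdet, htr, Real.log_prod fun i _ ↦ (hA.eigenvalues_pos i).ne']
  calc ∑ i, Real.log (hA.isHermitian.eigenvalues i)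
      ≤ ∑ i, (hA.isHermitian.eigenvalues i - 1) :=
        Finset.sum_le_sum fun i _ ↦ Real.log_le_sub_one_of_pos (hA.eigenvalues_pos i)
    _ = _ := by simp [Finset.sum_sub_distrib]

/-- The concave function `log det` lies below its tangent plane at `B`. -/
theorem Matrix.PosDef.log_det_le_log_det_add_trace {n : Type*} [Fintype n] [DecidableEq n]
    {A B : Matrix n n ℝ} (hA : A.PosDef) (hB : B.PosDef) :
    Real.log A.det ≤ Real.log B.det + (B⁻¹ * A).trace - Fintype.card n := by
  obtain ⟨T, hT⟩ : ∃ T : Matrix n n ℝ, B⁻¹ = Tᴴ * T := by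
    open scoped MatrixOrder in
    exact CStarAlgebra.nonneg_iff_eq_star_mul_self.mp hB.inv.posSemidef.nonneg
  have hTunit : IsUnit T := by
    have h : IsUnit (Tᴴ * T).det := hT ▸ (Matrix.isUnit_iff_isUnit_det _).mp hB.inv.isUnit
    rw [Matrix.det_mul] at h
    exact (Matrix.isUnit_iff_isUnit_det _).mpr (isUnit_of_mul_isUnit_right h)
  have hC : (T * A * Tᴴ).PosDef := (hTunit.posDef_star_right_conjugate_iff).mpr hA
  have htr : (T * A * Tᴴ).trace = (B⁻¹ * A).trace := by
    rw [hT, Matrix.trace_mul_comm, Matrix.mul_assoc]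
  have hdet : (T * A * Tᴴ).det = B.det⁻¹ * A.det := by
    have h : B⁻¹.det = B.det⁻¹ := by rw [Matrix.det_nonsing_inv, Ring.inverse_eq_inv']
    rw [← h, hT]
    simp only [Matrix.det_mul]
    ring
  have h := hC.log_det_le_trace_sub_card
  rw [htr, hdet, Real.log_mul (inv_ne_zero hB.det_pos.ne') hA.det_pos.ne', Real.log_inv] at h
  linarith

/-- Jensen's inequality for `log det` on positive definite matrices. -/
theorem Matrix.sum_mul_log_det_le_log_det_sum {ι n : Type*} [Fintype n] [DecidableEq n]
    (s : Finset ι) (w : ι → ℝ) (A : ι → Matrix n n ℝ) (hw : ∀ i ∈ s, 0 < w i)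
    (hw1 : ∑ i ∈ s, w i = 1) (hA : ∀ i ∈ s, (A i).PosDef) :
    ∑ i ∈ s, w i * Real.log (A i).det ≤ Real.log (∑ i ∈ s, w i • A i).det := by
  set B := ∑ i ∈ s, w i • A i with hBdef
  have hs : s.Nonempty := Finset.nonempty_of_sum_ne_zero (hw1 ▸ one_ne_zero)
  have hB : B.PosDef := Matrix.posDef_sum hs fun i hi ↦ (hA i hi).smul (hw i hi)
  have htr : ∑ i ∈ s, w i * (B⁻¹ * A i).trace = Fintype.card n := by
    have h : ∑ i ∈ s, w i * (B⁻¹ * A i).trace = (B⁻¹ * B).trace := by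
      have hsum : B⁻¹ * B = ∑ i ∈ s, w i • (B⁻¹ * A i) := by
        conv_lhs => enter [2]; rw [hBdef]
        simp only [Finset.mul_sum, Matrix.mul_smul]
      simp [hsum, Matrix.trace_sum]
    rw [h, Matrix.nonsing_inv_mul _ hB.det_pos.ne'.isUnit, Matrix.trace_one]
  calc ∑ i ∈ s, w i * Real.log (A i).det
      ≤ ∑ i ∈ s, w i * (Real.log B.det + (B⁻¹ * A i).trace - Fintype.card n) :=
        Finset.sum_le_sum fun i hi ↦ mul_le_mul_of_nonneg_left
          ((hA i hi).log_det_le_log_det_add_trace hB) (hw i hi).le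
    _ = Real.log B.det := by
        simp only [mul_sub, mul_add, Finset.sum_sub_distrib, Finset.sum_add_distrib,
          ← Finset.sum_mul, hw1, htr]
        ring

theorem Matrix.posDef_one_add_smul_mul_transpose {n k : Type*} [Fintype n] [DecidableEq n]
    [Fintype k] (Z : Matrix n k ℝ) {c : ℝ} (hc : 0 ≤ c) :
    (1 + c • (Z * Zᵀ)).PosDef := by
  have hZ : (Z * Zᵀ).PosSemidef := by
    simpa [Matrix.conjTranspose_eq_transpose_of_trivial] using
      Matrix.posSemidef_self_mul_conjTranspose Z
  exact Matrix.PosDef.one.add_posSemidef (hZ.smul hc)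

open Matrix BigOperators

/-- inequality (4) of the paper.
The global coding rate `R(Z, ε) = (1/2) log det(I + (d/(m ε²)) Z Zᵀ)` of the horizontal
concatenation `Z = [Z_1, …, Z_N]` (so that `Z Zᵀ = Σ_i Z_i Z_iᵀ`) dominates the weighted
sum of the local coding rates. -/
theorem coding_rate_jensen_lower_bound
    (d N : ℕ) (hN : 1 ≤ N)
    (m : Fin N → ℕ) (hm : ∀ i, 0 < m i)
    (Z : ∀ i : Fin N, Matrix (Fin d) (Fin (m i)) ℝ)
    (ε : ℝ) (hε : 0 < ε) :
    (1 / 2) * Real.log (Matrix.det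
        (1 + ((d : ℝ) / ((∑ i, (m i : ℝ)) * ε ^ 2)) • ∑ i, Z i * (Z i)ᵀ))
      ≥ ∑ i, ((m i : ℝ) / (2 * ∑ j, (m j : ℝ))) * Real.log (Matrix.det
        (1 + ((d : ℝ) / ((m i : ℝ) * ε ^ 2)) • (Z i * (Z i)ᵀ))) := by
  have hm' (i) : (0 : ℝ) < m i := Nat.cast_pos.mpr (hm i)
  have hM : (0 : ℝ) < ∑ i, (m i : ℝ) :=
    Finset.sum_pos (fun i _ ↦ hm' i) ⟨⟨0, hN⟩, Finset.mem_univ _⟩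
  set M : ℝ := ∑ i, (m i : ℝ)
  let A (i : Fin N) : Matrix (Fin d) (Fin d) ℝ :=
    1 + ((d : ℝ) / ((m i : ℝ) * ε ^ 2)) • (Z i * (Z i)ᵀ)
  have hA (i) : (A i).PosDef := posDef_one_add_smul_mul_transpose (Z i) (by positivity)
  have hw1 : ∑ i, (m i : ℝ) / M = 1 := by rw [← Finset.sum_div, div_self hM.ne']
  clear_value M
  have hmean : ∑ i, ((m i : ℝ) / M) • A i =
      1 + ((d : ℝ) / (M * ε ^ 2)) • ∑ i, Z i * (Z i)ᵀ := by
    simp only [A, smul_add, Finset.sum_add_distrib, ← Finset.sum_smul, hw1, one_smul,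
      Finset.smul_sum, smul_smul]
    congr 1
    refine Finset.sum_congr rfl fun i _ ↦ ?_
    congr 1
    have := (hm' i).ne'
    field_simp
  have h := sum_mul_log_det_le_log_det_sum Finset.univ (fun i ↦ (m i : ℝ) / M) A
    (fun i _ ↦ div_pos (hm' i) hM) hw1 fun i _ ↦ hA i
  rw [hmean] at h
  calc ∑ i, ((m i : ℝ) / (2 * M)) * Real.log (A i).det
      = (1 / 2) * ∑ i, ((m i : ℝ) / M) * Real.log (A i).det := by
        rw [Finset.mul_sum]
        refine Finset.sum_congr rfl fun i _ ↦ ?_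
        field_simp
    _ ≤ _ := mul_le_mul_of_nonneg_left h (by norm_num)
end

section
/- Let N ≥ 1 and for each i = 1, …, N let Z_i be a real d × m_i matrix with m_i a positive integer, let m = Σ_{i=1}^N m_i, and let ε > 0. Then equality holds in the Jensen bound (1/2)·log det( I_d + (d/(m ε²)) · Σ_{i=1}^N Z_i Z_iᵀ ) ≥ Σ_{i=1}^N (m_i/(2m)) · log det( I_d + (d/(m_i ε²)) · Z_i Z_iᵀ ) if and only if (1/m_i)·Z_i Z_iᵀ = (1/m_j)·Z_j Z_jᵀ for every pair of indices i, j ∈ {1, …, N}. -/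
open Matrix BigOperators

namespace Matrix

variable {n : Type*} [Fintype n] [DecidableEq n]

/-- The bound `log (det A) ≤ tr A - n` is strict away from the identity. -/
theorem PosDef.log_det_lt_trace_sub_card {A : Matrix n n ℝ} (hA : A.PosDef) (hA1 : A ≠ 1) :
    Real.log A.det < A.trace - Fintype.card n := by
  have hne : ∃ i, hA.1.eigenvalues i ≠ 1 := by
    by_contra! h
    apply hA1
    have hdiag : RCLike.ofReal ∘ hA.1.eigenvalues = fun _ => (1 : ℝ) := by
      funext i
      simp [h i]
    rw [hA.1.spectral_theorem, hdiag, diagonal_one, map_one]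
  obtain ⟨i, hi⟩ := hne
  rw [hA.1.det_eq_prod_eigenvalues, hA.1.trace_eq_sum_eigenvalues]
  simp only [RCLike.ofReal_real_eq_id, id_eq]
  rw [Real.log_prod fun j _ => (hA.eigenvalues_pos j).ne']
  calc ∑ j, Real.log (hA.1.eigenvalues j) < ∑ j, (hA.1.eigenvalues j - 1) :=
        Finset.sum_lt_sum (fun j _ => Real.log_le_sub_one_of_pos (hA.eigenvalues_pos j))
          ⟨i, Finset.mem_univ i, Real.log_lt_sub_one_of_pos (hA.eigenvalues_pos i) hi⟩
    _ = _ := by simp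

open scoped MatrixOrder Matrix.Norms.L2Operator in
theorem PosDef.exists_isUnit_eq_star_mul_self {A : Matrix n n ℝ} (hA : A.PosDef) :
    ∃ B : Matrix n n ℝ, IsUnit B ∧ A = star B * B :=
  CStarAlgebra.isStrictlyPositive_iff_eq_star_mul_self.mp hA.isStrictlyPositive

/-- The tangent-plane bound for `log ∘ det` at `M`, strict away from `M`. -/
theorem PosDef.log_det_lt_log_det_add {M S : Matrix n n ℝ} (hM : M.PosDef) (hS : S.PosDef)
    (hSM : S ≠ M) :
    Real.log S.det < Real.log M.det + ((M⁻¹ * S).trace - Fintype.card n) := by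
  obtain ⟨B, hB, hMB⟩ := hM.inv.exists_isUnit_eq_star_mul_self
  have hC : (B * S * star B).PosDef := (IsUnit.posDef_star_right_conjugate_iff hB).mpr hS
  have hMdet : IsUnit M.det := (isUnit_iff_isUnit_det M).mp hM.isUnit
  have hC1 : B * S * star B ≠ 1 := by
    intro h
    apply hSM
    have h1 : S * star B * B = 1 := by
      rw [mul_eq_one_comm, ← mul_assoc]
      exact h
    rw [mul_assoc, ← hMB] at h1
    rw [← nonsing_inv_nonsing_inv M hMdet]
    exact (inv_eq_left_inv h1).symm
  have hlog := hC.log_det_lt_trace_sub_card hC1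
  have htr : (B * S * star B).trace = (M⁻¹ * S).trace := by
    rw [trace_mul_comm, ← mul_assoc, ← hMB]
  have hdet : (B * S * star B).det = M.det⁻¹ * S.det := by
    rw [det_mul_comm, ← mul_assoc, ← hMB, det_mul, det_nonsing_inv, Ring.inverse_eq_inv']
  rw [htr, hdet, Real.log_mul (inv_ne_zero hM.det_pos.ne') hS.det_pos.ne', Real.log_inv] at hlog
  linarith

theorem strictConcaveOn_log_det :
    StrictConcaveOn ℝ {A : Matrix n n ℝ | A.PosDef} fun A => Real.log A.det := by
  have hconv {A B : Matrix n n ℝ} (hA : A.PosDef) (hB : B.PosDef) {a b : ℝ} (ha : 0 ≤ a)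
      (hb : 0 ≤ b) (hab : a + b = 1) : (a • A + b • B).PosDef := by
    rcases ha.eq_or_lt with rfl | ha
    · obtain rfl : b = 1 := by linarith
      simpa using hB
    · exact (hA.smul ha).add_posSemidef (hB.posSemidef.smul hb)
  refine ⟨fun A hA B hB a b ha hb hab => hconv hA hB ha hb hab, ?_⟩
  intro A hA B hB hAB a b ha hb hab
  have hM := hconv hA hB ha.le hb.le hab
  set M := a • A + b • B with hMdef
  have hAM : A ≠ M := by
    intro h
    apply hAB
    have : b • A = b • B := by
      have h1 : a • A + b • A = a • A + b • B := by rw [← add_smul, hab, one_smul]; exact h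
      exact add_left_cancel h1
    exact smul_right_injective _ hb.ne' this
  have hBM : B ≠ M := by
    intro h
    apply hAB
    have : a • A = a • B := by
      have h1 : a • A + b • B = a • B + b • B := by rw [← add_smul, hab, one_smul]; exact h.symm
      exact add_right_cancel h1
    exact smul_right_injective _ ha.ne' this
  have h1 := mul_lt_mul_of_pos_left (hM.log_det_lt_log_det_add hA hAM) ha
  have h2 := mul_lt_mul_of_pos_left (hM.log_det_lt_log_det_add hB hBM) hb
  have htr : a * (M⁻¹ * A).trace + b * (M⁻¹ * B).trace = Fintype.card n := by
    have hexp (P : Matrix n n ℝ) : a * (P * A).trace + b * (P * B).trace = (P * M).trace := by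
      simp [hMdef, mul_add]
    rw [hexp, nonsing_inv_mul M ((isUnit_iff_isUnit_det M).mp hM.isUnit), trace_one]
  simp only [smul_eq_mul]
  linear_combination h1 + h2 + htr + (Real.log M.det - Fintype.card n) * hab

end Matrix

/-- equality holds in the Jensen bound (4) of the paper if and only if
the normalized covariances `(1/m_i) Z_i Z_iᵀ` coincide for all pairs of nodes. -/
theorem coding_rate_jensen_equality_iff
    (d N : ℕ) (hN : 1 ≤ N)
    (m : Fin N → ℕ) (hm : ∀ i, 0 < m i)
    (Z : ∀ i : Fin N, Matrix (Fin d) (Fin (m i)) ℝ)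
    (ε : ℝ) (hε : 0 < ε) :
    (1 / 2) * Real.log (Matrix.det
        (1 + ((d : ℝ) / ((∑ i, (m i : ℝ)) * ε ^ 2)) • ∑ i, Z i * (Z i)ᵀ))
      = ∑ i, ((m i : ℝ) / (2 * ∑ j, (m j : ℝ))) * Real.log (Matrix.det
        (1 + ((d : ℝ) / ((m i : ℝ) * ε ^ 2)) • (Z i * (Z i)ᵀ)))
    ↔ ∀ i j : Fin N,
        (1 / (m i : ℝ)) • (Z i * (Z i)ᵀ) = (1 / (m j : ℝ)) • (Z j * (Z j)ᵀ) := by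
  have hmpos (i : Fin N) : (0 : ℝ) < m i := Nat.cast_pos.mpr (hm i)
  have hε2 : ε ^ 2 ≠ 0 := (pow_pos hε 2).ne'
  have hMpos : 0 < ∑ i, (m i : ℝ) :=
    Finset.sum_pos (fun i _ => hmpos i) ⟨⟨0, hN⟩, Finset.mem_univ _⟩
  generalize hμ : ∑ i, (m i : ℝ) = μ at hMpos ⊢
  let S (i : Fin N) : Matrix (Fin d) (Fin d) ℝ :=
    1 + ((d : ℝ) / ((m i : ℝ) * ε ^ 2)) • (Z i * (Z i)ᵀ)
  have hS (i : Fin N) : (S i).PosDef := by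
    refine PosDef.one.add_posSemidef (PosSemidef.smul ?_ (by positivity))
    simpa using posSemidef_self_mul_conjTranspose (Z i)
  have hw : ∑ i, (m i : ℝ) / μ = 1 := by
    rw [← Finset.sum_div, hμ, div_self hMpos.ne']
  have hmean : ∑ i, ((m i : ℝ) / μ) • S i
      = 1 + ((d : ℝ) / (μ * ε ^ 2)) • ∑ i, Z i * (Z i)ᵀ := by
    simp only [S, smul_add, Finset.sum_add_distrib, ← Finset.sum_smul, hw, one_smul, smul_smul,
      Finset.smul_sum]
    congr! 3 with i
    have := (hmpos i).ne'
    field_simp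
  have hjensen := strictConcaveOn_log_det.map_sum_eq_iff (t := Finset.univ)
    (w := fun i => (m i : ℝ) / μ) (p := S) (fun i _ => div_pos (hmpos i) hMpos) hw
    (fun i _ => hS i)
  have hrhs : ∑ i, ((m i : ℝ) / (2 * μ)) * Real.log (S i).det
      = (1 / 2) * ∑ i, ((m i : ℝ) / μ) • Real.log (S i).det := by
    rw [Finset.mul_sum]
    refine Finset.sum_congr rfl fun i _ => ?_
    rw [smul_eq_mul]
    field_simp
  have hpair (i j : Fin N) : S i = S j ↔
      (1 / (m i : ℝ)) • (Z i * (Z i)ᵀ) = (1 / (m j : ℝ)) • (Z j * (Z j)ᵀ) := by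
    rcases Nat.eq_zero_or_pos d with rfl | hd
    · exact iff_of_true (Subsingleton.elim _ _) (Subsingleton.elim _ _)
    · have hc : (d : ℝ) / ε ^ 2 ≠ 0 := div_ne_zero (Nat.cast_ne_zero.mpr hd.ne') hε2
      have hscale (k : Fin N) :
          S k = 1 + ((d : ℝ) / ε ^ 2) • ((1 / (m k : ℝ)) • (Z k * (Z k)ᵀ)) := by
        simp only [S, smul_smul]
        congr 2
        have := (hmpos k).ne'
        field_simp
      rw [hscale i, hscale j, add_right_inj, (smul_right_injective (Matrix (Fin d) (Fin d) ℝ) hc).eq_iff]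
  change _ = ∑ i, ((m i : ℝ) / (2 * μ)) * Real.log (S i).det ↔ _
  rw [hrhs, ← hmean, mul_right_inj' (by norm_num : (1 / 2 : ℝ) ≠ 0), hjensen]
  simp only [← hpair]
  constructor
  · intro h i j
    rw [h i (Finset.mem_univ i), h j (Finset.mem_univ j)]
  · intro h j _
    simp only [fun i => h i j, ← Finset.sum_smul, hw, one_smul]
end

section
/- Fix a class index k. Let N ≥ 1 and for each node i = 1, …, N let Z_{i,k} be a real d × m_{i,k} matrix with m_{i,k} a positive integer, let m_k = Σ_{i=1}^N m_{i,k}, let m > 0 and ε > 0. Assume the class-wise variance consensus (1/m_{i,k})·Z_{i,k} Z_{i,k}ᵀ = (1/m_{j,k})·Z_{j,k} Z_{j,k}ᵀ holds for all pairs of nodes i, j. Then (m_k/(2m))·log det( I_d + (d/(m_k ε²)) · Σ_{i=1}^N Z_{i,k} Z_{i,k}ᵀ ) = Σ_{i=1}^N (m_{i,k}/(2m))·log det( I_d + (d/(m_{i,k} ε²)) · Z_{i,k} Z_{i,k}ᵀ ). (This is the per-class identity underlying the decomposition (5) of the class-conditional coding rate R^c.) -/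
open Matrix BigOperators

/-- per-class identity underlying decomposition (5) of the paper.
Fix a class `k`.  Under the class-wise variance consensus
`(1/m_{i,k}) Z_{i,k} Z_{i,k}ᵀ = (1/m_{j,k}) Z_{j,k} Z_{j,k}ᵀ` across all node pairs,
the class-conditional coding rate splits exactly into the sum of local ones. -/
theorem class_coding_rate_decomposition
    (d N : ℕ) (hN : 1 ≤ N)
    (mik : Fin N → ℕ) (hmik : ∀ i, 0 < mik i)
    (Z : ∀ i : Fin N, Matrix (Fin d) (Fin (mik i)) ℝ)
    (mtot ε : ℝ) (hmtot : 0 < mtot) (hε : 0 < ε)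
    (hcons : ∀ i j : Fin N,
      (1 / (mik i : ℝ)) • (Z i * (Z i)ᵀ) = (1 / (mik j : ℝ)) • (Z j * (Z j)ᵀ)) :
    ((∑ i, (mik i : ℝ)) / (2 * mtot)) * Real.log (Matrix.det
        (1 + ((d : ℝ) / ((∑ i, (mik i : ℝ)) * ε ^ 2)) • ∑ i, Z i * (Z i)ᵀ))
      = ∑ i, ((mik i : ℝ) / (2 * mtot)) * Real.log (Matrix.det
        (1 + ((d : ℝ) / ((mik i : ℝ) * ε ^ 2)) • (Z i * (Z i)ᵀ))) := by
  obtain ⟨C, hC⟩ : ∃ C : Matrix (Fin d) (Fin d) ℝ, ∀ i, Z i * (Z i)ᵀ = (mik i : ℝ) • C := by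
    refine ⟨(1 / (mik ⟨0, hN⟩ : ℝ)) • (Z ⟨0, hN⟩ * (Z ⟨0, hN⟩)ᵀ), fun i => ?_⟩
    have hi : (mik i : ℝ) ≠ 0 := Nat.cast_ne_zero.mpr (hmik i).ne'
    rw [← hcons i, smul_smul, mul_one_div_cancel hi, one_smul]
  have scale (a : ℝ) (ha : a ≠ 0) :
      ((d : ℝ) / (a * ε ^ 2)) • (a • C) = ((d : ℝ) / ε ^ 2) • C := by
    rw [smul_smul]
    congr 1
    field_simp
  have hsum : ∑ i, (mik i : ℝ) ≠ 0 :=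
    (Finset.sum_pos (fun i _ => Nat.cast_pos.mpr (hmik i)) ⟨⟨0, hN⟩, Finset.mem_univ _⟩).ne'
  have hlocal (i : Fin N) :
      ((d : ℝ) / ((mik i : ℝ) * ε ^ 2)) • (Z i * (Z i)ᵀ) = ((d : ℝ) / ε ^ 2) • C := by
    rw [hC, scale _ (Nat.cast_ne_zero.mpr (hmik i).ne')]
  simp_rw [hlocal, hC]
  rw [← Finset.sum_smul, scale _ hsum, Finset.sum_div, Finset.sum_mul]
end

section
/- Let S ≥ 1 be a number of clusters. For each cluster s = 1, …, S let Ṽ^s be a finite set of node indices, and for each node i let Z_i be a real d × m_i matrix with m_i a positive integer and let S_i ≥ 1 be an integer (the replication count of node i). Define m^s = Σ_{i∈Ṽ^s} m_i/S_i, let m = Σ_{s=1}^S m^s, assume each m^s > 0, and let ε > 0. Then (1/2)·log det( I_d + (d/(m ε²)) · Σ_{s=1}^S Σ_{i∈Ṽ^s} (1/S_i)·Z_i Z_iᵀ ) ≥ Σ_{s=1}^S (m^s/(2m))·log det( I_d + (d/(m^s ε²)) · Σ_{i∈Ṽ^s} (1/S_i)·Z_i Z_iᵀ ). (This is inequality (12),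 the clustered Jensen lower bound on the global coding rate.) -/
open Matrix BigOperators

namespace Matrix

variable {n : Type*} [Fintype n] [DecidableEq n]

lemma PosDef.log_det_le_trace_sub_card_s3 {A : Matrix n n ℝ} (hA : A.PosDef) :
    Real.log A.det ≤ A.trace - Fintype.card n := by
  have hdet : A.det = ∏ i, hA.isHermitian.eigenvalues i := by
    simpa using hA.isHermitian.det_eq_prod_eigenvalues
  have htrace : A.trace = ∑ i, hA.isHermitian.eigenvalues i := by
    simpa using hA.isHermitian.trace_eq_sum_eigenvalues
  rw [hdet, htrace, Real.log_prod fun i _ => (hA.eigenvalues_pos i).ne']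
  calc ∑ i, Real.log (hA.isHermitian.eigenvalues i)
      ≤ ∑ i, (hA.isHermitian.eigenvalues i - 1) :=
        Finset.sum_le_sum fun i _ => Real.log_le_sub_one_of_pos (hA.eigenvalues_pos i)
    _ = _ := by simp [Finset.sum_sub_distrib]

open scoped MatrixOrder in
/-- The graph of `log det` lies below its tangent plane at `B`. -/
lemma PosDef.log_det_le_log_det_add_trace_s3 {A B : Matrix n n ℝ} (hA : A.PosDef) (hB : B.PosDef) :
    Real.log A.det ≤ Real.log B.det + ((B⁻¹ * A).trace - Fintype.card n) := by
  obtain ⟨C, hC⟩ := CStarAlgebra.nonneg_iff_eq_star_mul_self.mp hB.inv.posSemidef.nonneg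
  have hCdet : C.det ≠ 0 := by
    intro h
    have := hB.inv.det_pos
    rw [hC, det_mul, h, mul_zero] at this
    exact this.false
  have hCunit : IsUnit C := (isUnit_iff_isUnit_det C).2 (isUnit_iff_ne_zero.2 hCdet)
  have hM : (C * A * star C).PosDef := (IsUnit.posDef_star_right_conjugate_iff hCunit).2 hA
  have htrace : (C * A * star C).trace = (B⁻¹ * A).trace := by
    rw [trace_mul_comm, ← mul_assoc, ← hC]
  have hdet : (C * A * star C).det = (B.det)⁻¹ * A.det := by
    have h : (B.det)⁻¹ = (star C).det * C.det := by
      rw [← det_mul, ← hC, det_nonsing_inv, Ring.inverse_eq_inv']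
    rw [h, det_mul, det_mul]
    ring
  have h := hM.log_det_le_trace_sub_card_s3
  rw [htrace, hdet, Real.log_mul (inv_ne_zero hB.det_pos.ne') hA.det_pos.ne', Real.log_inv] at h
  linarith

/-- Jensen's inequality for the concave function `log det` on positive definite matrices. -/
lemma sum_mul_log_det_le_log_det_sum_s3 {κ : Type*} (s : Finset κ) {w : κ → ℝ}
    {A : κ → Matrix n n ℝ} (hw : ∀ i ∈ s, 0 ≤ w i) (hw1 : ∑ i ∈ s, w i = 1)
    (hA : ∀ i ∈ s, (A i).PosDef) (hB : (∑ i ∈ s, w i • A i).PosDef) :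
    ∑ i ∈ s, w i * Real.log (A i).det ≤ Real.log (∑ i ∈ s, w i • A i).det := by
  set B := ∑ i ∈ s, w i • A i with hBdef
  have htrace : ∑ i ∈ s, w i * (B⁻¹ * A i).trace = Fintype.card n := by
    calc ∑ i ∈ s, w i * (B⁻¹ * A i).trace = (B⁻¹ * B).trace := by
          conv_rhs => rw [hBdef, Finset.mul_sum, trace_sum]
          simp [← hBdef]
      _ = _ := by rw [nonsing_inv_mul B (isUnit_iff_ne_zero.2 hB.det_pos.ne'), trace_one]
  calc ∑ i ∈ s, w i * Real.log (A i).det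
      ≤ ∑ i ∈ s, w i * (Real.log B.det + ((B⁻¹ * A i).trace - Fintype.card n)) :=
        Finset.sum_le_sum fun i hi =>
          mul_le_mul_of_nonneg_left ((hA i hi).log_det_le_log_det_add_trace_s3 hB) (hw i hi)
    _ = Real.log B.det := by
        simp only [mul_add, mul_sub, Finset.sum_add_distrib, Finset.sum_sub_distrib,
          ← Finset.sum_mul, hw1, htrace]
        ring

end Matrix

/-- inequality (12) of the paper: the clustered Jensen lower bound on the
global coding rate, with clusters `Ṽ^s`, replication counts `S_i ≥ 1`, effective cluster
sample counts `m^s = Σ_{i∈Ṽ^s} m_i / S_i` and total `m = Σ_s m^s`. -/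
theorem clustered_coding_rate_jensen_lower_bound
    (d S : ℕ) (hS : 1 ≤ S) {ι : Type*}
    (V : Fin S → Finset ι)
    (mI : ι → ℕ) (hmI : ∀ i, 0 < mI i)
    (Si : ι → ℕ) (hSi : ∀ i, 1 ≤ Si i)
    (Z : ∀ i : ι, Matrix (Fin d) (Fin (mI i)) ℝ)
    (ε : ℝ) (hε : 0 < ε)
    (hms : ∀ s, 0 < ∑ i ∈ V s, (mI i : ℝ) / (Si i : ℝ)) :
    (1 / 2) * Real.log (Matrix.det
        (1 + ((d : ℝ) / ((∑ s, ∑ i ∈ V s, (mI i : ℝ) / (Si i : ℝ)) * ε ^ 2)) •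
          ∑ s, ∑ i ∈ V s, ((Si i : ℝ)⁻¹) • (Z i * (Z i)ᵀ)))
      ≥ ∑ s, ((∑ i ∈ V s, (mI i : ℝ) / (Si i : ℝ)) /
            (2 * ∑ s', ∑ i ∈ V s', (mI i : ℝ) / (Si i : ℝ))) * Real.log (Matrix.det
        (1 + ((d : ℝ) / ((∑ i ∈ V s, (mI i : ℝ) / (Si i : ℝ)) * ε ^ 2)) •
          ∑ i ∈ V s, ((Si i : ℝ)⁻¹) • (Z i * (Z i)ᵀ))) := by
  let P : Fin S → Matrix (Fin d) (Fin d) ℝ :=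
    fun s => ∑ i ∈ V s, ((Si i : ℝ)⁻¹) • (Z i * (Z i)ᵀ)
  let a : Fin S → ℝ := fun s => ∑ i ∈ V s, (mI i : ℝ) / (Si i : ℝ)
  have hpsd : ∀ s, (P s).PosSemidef := fun s =>
    posSemidef_sum _ fun i _ => by
      simpa using (posSemidef_self_mul_conjTranspose (Z i)).smul
        (inv_nonneg.2 (Nat.cast_nonneg (α := ℝ) (Si i)))
  have hpos : ∀ s, 0 < a s := hms
  have hm : 0 < ∑ s, a s :=
    Finset.sum_pos (fun s _ => hpos s) ⟨⟨0, hS⟩, Finset.mem_univ _⟩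
  change (1 / 2) * Real.log (det (1 + ((d : ℝ) / ((∑ s, a s) * ε ^ 2)) • ∑ s, P s)) ≥
    ∑ s, (a s / (2 * ∑ s', a s')) * Real.log (det (1 + ((d : ℝ) / (a s * ε ^ 2)) • P s))
  let m : ℝ := ∑ s, a s
  have hw1 : ∑ s, a s / m = 1 := by rw [← Finset.sum_div, div_self hm.ne']
  have hA : ∀ s, (1 + ((d : ℝ) / (a s * ε ^ 2)) • P s).PosDef := fun s =>
    PosDef.one.add_posSemidef ((hpsd s).smul (by have := hpos s; positivity))
  have hB : (1 + ((d : ℝ) / (m * ε ^ 2)) • ∑ s, P s).PosDef :=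
    PosDef.one.add_posSemidef ((posSemidef_sum _ fun s _ => hpsd s).smul (by positivity))
  have hsum : ∑ s, (a s / m) • (1 + ((d : ℝ) / (a s * ε ^ 2)) • P s) =
      1 + ((d : ℝ) / (m * ε ^ 2)) • ∑ s, P s := by
    simp only [smul_add, Finset.sum_add_distrib, ← Finset.sum_smul, hw1, one_smul,
      Finset.smul_sum, smul_smul]
    congr 1
    refine Finset.sum_congr rfl fun s _ => ?_
    have := (hpos s).ne'
    congr 1
    field_simp
  have h := sum_mul_log_det_le_log_det_sum_s3 Finset.univ
    (fun s _ => (div_pos (hpos s) hm).le) hw1 (fun s _ => hA s) (hsum ▸ hB)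
  rw [hsum] at h
  have hweight : ∀ s, a s / (2 * m) = 1 / 2 * (a s / m) := fun s => by field_simp
  refine le_of_eq_of_le ?_ (mul_le_mul_of_nonneg_left h (by norm_num : (0 : ℝ) ≤ 1 / 2))
  rw [Finset.mul_sum Finset.univ _ (1 / 2 : ℝ)]
  refine Finset.sum_congr rfl fun s _ => ?_
  rw [← mul_assoc, ← hweight]
end

section
/- Fix a class index k. Let S ≥ 1 be a number of clusters and for each s = 1, …, S let Ṽ_k^s be a finite set of node indices holding class k. For each node i in these sets let Z_{i,k} be a real d × m_{i,k} matrix with m_{i,k} a positive integer and S_i ≥ 1 an integer. Define m_k^s = Σ_{i∈Ṽ_k^s} m_{i,k}/S_i, assume each m_k^s > 0, let m_k = Σ_{s=1}^S m_k^s, let m > 0 and ε > 0. Assume the class-wise variance consensus: there is a positive semidefinite d × d matrix W_k with (1/m_{i,k})·Z_{i,k} Z_{i,k}ᵀ = W_k for every node i appearing in any Ṽ_k^s. Then (m_k/(2m))·log det( I_d + (d/(m_k ε²)) · Σ_{s=1}^S Σ_{i∈Ṽ_k^s} (1/S_i)·Z_{i,k} Z_{i,k}ᵀ ) = Σ_{s=1}^S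 (m_k^s/(2m))·log det( I_d + (d/(m_k^s ε²)) · Σ_{i∈Ṽ_k^s} (1/S_i)·Z_{i,k} Z_{i,k}ᵀ ). (This is the per-class identity underlying the clustered decomposition (13) of the class-conditional coding rate.) -/
open Matrix BigOperators

/-- per-class identity underlying the clustered decomposition (13).
Fix a class `k`.  With node sets `Ṽ_k^s` per cluster, replication counts `S_i ≥ 1`,
effective per-cluster class counts `m_k^s = Σ_{i∈Ṽ_k^s} m_{i,k}/S_i > 0`, total
`m_k = Σ_s m_k^s`, and the class-wise variance consensus
`(1/m_{i,k}) Z_{i,k} Z_{i,k}ᵀ = W_k` (a single PSD matrix) for every node appearing in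
any `Ṽ_k^s`, the class-conditional coding rate decomposes exactly over the clusters. -/
theorem clustered_class_coding_rate_decomposition
    (d S : ℕ) (hS : 1 ≤ S) {ι : Type*}
    (Vk : Fin S → Finset ι)
    (mik : ι → ℕ) (hmik : ∀ i, 0 < mik i)
    (Si : ι → ℕ) (hSi : ∀ i, 1 ≤ Si i)
    (Z : ∀ i : ι, Matrix (Fin d) (Fin (mik i)) ℝ)
    (mtot ε : ℝ) (hmtot : 0 < mtot) (hε : 0 < ε)
    (hmks : ∀ s, 0 < ∑ i ∈ Vk s, (mik i : ℝ) / (Si i : ℝ))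
    (W : Matrix (Fin d) (Fin d) ℝ) (hW : W.PosSemidef)
    (hcons : ∀ s, ∀ i ∈ Vk s, (1 / (mik i : ℝ)) • (Z i * (Z i)ᵀ) = W) :
    ((∑ s, ∑ i ∈ Vk s, (mik i : ℝ) / (Si i : ℝ)) / (2 * mtot)) * Real.log (Matrix.det
        (1 + ((d : ℝ) / ((∑ s, ∑ i ∈ Vk s, (mik i : ℝ) / (Si i : ℝ)) * ε ^ 2)) •
          ∑ s, ∑ i ∈ Vk s, ((Si i : ℝ)⁻¹) • (Z i * (Z i)ᵀ)))
      = ∑ s, ((∑ i ∈ Vk s, (mik i : ℝ) / (Si i : ℝ)) / (2 * mtot)) * Real.log (Matrix.det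
        (1 + ((d : ℝ) / ((∑ i ∈ Vk s, (mik i : ℝ) / (Si i : ℝ)) * ε ^ 2)) •
          ∑ i ∈ Vk s, ((Si i : ℝ)⁻¹) • (Z i * (Z i)ᵀ))) := by
  have gram : ∀ s, ∑ i ∈ Vk s, ((Si i : ℝ)⁻¹) • (Z i * (Z i)ᵀ)
      = (∑ i ∈ Vk s, (mik i : ℝ) / (Si i : ℝ)) • W := by
    intro s
    rw [Finset.sum_smul]
    refine Finset.sum_congr rfl fun i hi => ?_
    have hm : (mik i : ℝ) ≠ 0 := Nat.cast_ne_zero.mpr (hmik i).ne'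
    rw [← hcons s i hi, smul_smul]
    congr 1
    field_simp
  have scale : ∀ a : ℝ, 0 < a → ((d : ℝ) / (a * ε ^ 2)) • a • W = ((d : ℝ) / ε ^ 2) • W := by
    intro a ha
    rw [smul_smul]
    congr 1
    field_simp
  have total_pos : 0 < ∑ s, ∑ i ∈ Vk s, (mik i : ℝ) / (Si i : ℝ) :=
    Finset.sum_pos (fun s _ => hmks s) ⟨⟨0, hS⟩, Finset.mem_univ _⟩
  simp only [gram, ← Finset.sum_smul, scale _ total_pos, scale _ (hmks _)]
  rw [← Finset.sum_mul, Finset.sum_div]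
end

section
/- Let ρ > 0 and γ > 0, and let (A^{(t)})_{t≥0} and (B^{(t)})_{t≥0} be two sequences of real d × d matrices. Define sequences U^{(t)}, V^{(t)}, T^{(t)} of real d × d matrices by: U^{(0)} = V^{(0)} = 0; T^{(t)} = (1/(2γ))·(U^{(t)} + V^{(t)}) + (1/2)·(A^{(t)} + B^{(t)}) for all t ≥ 0; and for t ≥ 1, U^{(t)} = U^{(t−1)} + ρ·(A^{(t−1)} − T^{(t−1)}) and V^{(t)} = V^{(t−1)} + ρ·(B^{(t−1)} − T^{(t−1)}). Then for every t ≥ 0: (i) U^{(t)} + V^{(t)} = 0; (ii) T^{(t)} = (1/2)·(A^{(t)} + B^{(t)}); and (iii) the variable Y^{(t)} := 2·U^{(t)} satisfies Y^{(0)} = 0 and, for t ≥ 1, the simplified recursion Y^{(t)} = Y^{(t−1)} + ρ·(A^{(t−1)} − B^{(t−1)}). (This is the simplification of the primal–dual update rules claimed in Proposition 1.) -/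
open Matrix BigOperators

/-- simplification of the primal–dual update rules, Proposition 1.
With `U⁰ = V⁰ = 0`, `T^t = (1/(2γ))(U^t+V^t) + (1/2)(A^t+B^t)` and the dual ascent steps
`U^t = U^{t−1} + ρ (A^{t−1} − T^{t−1})`, `V^t = V^{t−1} + ρ (B^{t−1} − T^{t−1})`, one has
for all `t`: (i) `U^t + V^t = 0`, (ii) `T^t = (1/2)(A^t+B^t)`, and (iii) `Y^t := 2 U^t`
satisfies `Y⁰ = 0` and `Y^t = Y^{t−1} + ρ (A^{t−1} − B^{t−1})` for `t ≥ 1`. -/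
theorem dual_update_simplification
    (d : ℕ) (ρ γ : ℝ) (hρ : 0 < ρ) (hγ : 0 < γ)
    (A B U V T : ℕ → Matrix (Fin d) (Fin d) ℝ)
    (hU0 : U 0 = 0) (hV0 : V 0 = 0)
    (hT : ∀ t, T t = (1 / (2 * γ)) • (U t + V t) + (1 / 2 : ℝ) • (A t + B t))
    (hU : ∀ t : ℕ, 1 ≤ t → U t = U (t - 1) + ρ • (A (t - 1) - T (t - 1)))
    (hV : ∀ t : ℕ, 1 ≤ t → V t = V (t - 1) + ρ • (B (t - 1) - T (t - 1))) :
    (∀ t, U t + V t = 0) ∧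
    (∀ t, T t = (1 / 2 : ℝ) • (A t + B t)) ∧
    ((2 : ℝ) • U 0 = 0 ∧
      ∀ t : ℕ, 1 ≤ t →
        (2 : ℝ) • U t = (2 : ℝ) • U (t - 1) + ρ • (A (t - 1) - B (t - 1))) := by
  have hsum : ∀ t, U t + V t = 0 := by
    intro t
    induction t with
    | zero => simp [hU0, hV0]
    | succ n ih =>
      have hTn : T n = (1 / 2 : ℝ) • (A n + B n) := by rw [hT, ih, smul_zero, zero_add]
      rw [hU (n + 1) (by lia), hV (n + 1) (by lia), Nat.add_sub_cancel, hTn,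
        eq_neg_of_add_eq_zero_left ih]
      module
  have hmean : ∀ t, T t = (1 / 2 : ℝ) • (A t + B t) := fun t => by
    rw [hT, hsum, smul_zero, zero_add]
  refine ⟨hsum, hmean, by rw [hU0, smul_zero], fun t ht => ?_⟩
  rw [hU t ht, hmean]
  module
end

section
/- Consider the distributed MCR² problem (6): N nodes on a connected simple graph, K classes with target subspace dimensions d_1, …, d_K; for node i and class k, Z_{i,k} is a real d × m_{i,k} matrix, Z_i is the concatenation of the Z_{i,k} over k (with m_i = Σ_k m_{i,k}), Z_k is the concatenation of the Z_{i,k} over i (with m_k = Σ_i m_{i,k}), and m = Σ_i m_i. Maximize Σ_{i=1}^N [ (m_i/(2m))·log det( I_d + (d/(m_i ε²)) Z_i Z_iᵀ ) − Σ_{k=1}^K (m_{i,k}/(2m))·log det( I_d + (d/(m_{i,k} ε²)) Z_{i,k} Z_{i,k}ᵀ ) ] over all choices of the matrices subject to: ‖Z_{i,k}‖_F² = m_{i,k} for all i, k; the neighbor consensus (1/m_{i,k})·Z_{i,k} Z_{i,k}ᵀ = (1/m_{j,k})·Z_{j,k} Z_{j,k}ᵀ for all edges {i,j} and classes k; and rank(Z_k)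 ≤ d_k for all k. Assume d ≥ Σ_{k=1}^K d_k, ε⁴ < min_k ( (m_k/m)·(d/d_k)² ), and Assumption 1 (m_{i,k}/m_i = m_{j,k}/m_j for all i, j, k). Then any optimal solution Z* satisfies: (1) (Z*_{i,k1})ᵀ Z*_{i,k2} = 0 for all nodes i and all distinct classes k1 ≠ k2; and (2) (Z*_{i,k1})ᵀ Z*_{j,k2} = 0 for all pairs of nodes i, j and all distinct classes k1 ≠ k2; i.e., the feature subspaces of different classes are mutually orthogonal, both within each node and across nodes. (Theorem 1, properties 1 and 2.) -/
open Matrix BigOperators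

noncomputable section

/-- Horizontal concatenation, over the nodes `i`, of the class-`k` feature blocks
`Z_{i,k} ∈ ℝ^{d × m_{i,k}}`: the matrix `Z_k = [Z_{1,k}, …, Z_{N,k}]`. -/
def classConcat {d : ℕ} {ι : Type*} {mk : ι → ℕ}
    (Zk : ∀ i, Matrix (Fin d) (Fin (mk i)) ℝ) :
    Matrix (Fin d) ((i : ι) × Fin (mk i)) ℝ :=
  fun r c => Zk c.1 r c.2

/-- The objective of the distributed MCR² problem (6):
`Σ_i [ (m_i/(2m)) log det(I + (d/(m_i ε²)) Z_i Z_iᵀ)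
       − Σ_k (m_{i,k}/(2m)) log det(I + (d/(m_{i,k} ε²)) Z_{i,k} Z_{i,k}ᵀ) ]`,
where `Z_i Z_iᵀ = Σ_k Z_{i,k} Z_{i,k}ᵀ`, `m_i = Σ_k m_{i,k}`, `m = Σ_i m_i`. -/
def mcr2Objective {d N K : ℕ} (ε : ℝ) (m : Fin N → Fin K → ℕ)
    (Z : ∀ i k, Matrix (Fin d) (Fin (m i k)) ℝ) : ℝ :=
  ∑ i, (((∑ k, (m i k : ℝ)) / (2 * ∑ i', ∑ k, (m i' k : ℝ))) * Real.log (Matrix.det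
          (1 + ((d : ℝ) / ((∑ k, (m i k : ℝ)) * ε ^ 2)) • ∑ k, Z i k * (Z i k)ᵀ))
      - ∑ k, ((m i k : ℝ) / (2 * ∑ i', ∑ k', (m i' k' : ℝ))) * Real.log (Matrix.det
          (1 + ((d : ℝ) / ((m i k : ℝ) * ε ^ 2)) • (Z i k * (Z i k)ᵀ))))

/-- The feasible set of the distributed MCR² problem (6): Frobenius normalization
`‖Z_{i,k}‖_F² = m_{i,k}`, neighbor class-wise variance consensus along the edges of the
communication graph `G`, and the rank constraints `rank(Z_k) ≤ d_k`. -/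
def mcr2Feasible {d N K : ℕ} (G : SimpleGraph (Fin N)) (dk : Fin K → ℕ)
    (m : Fin N → Fin K → ℕ)
    (Z : ∀ i k, Matrix (Fin d) (Fin (m i k)) ℝ) : Prop :=
  (∀ i k, Matrix.trace ((Z i k)ᵀ * Z i k) = (m i k : ℝ)) ∧
  (∀ i j : Fin N, G.Adj i j → ∀ k,
    (1 / (m i k : ℝ)) • (Z i k * (Z i k)ᵀ) = (1 / (m j k : ℝ)) • (Z j k * (Z j k)ᵀ)) ∧
  (∀ k, (classConcat (fun i => Z i k)).rank ≤ dk k)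

open scoped MatrixOrder in
theorem Matrix.PosSemidef.exists_eq_mul_transpose {n : Type*} [Fintype n] [DecidableEq n]
    {T : Matrix n n ℝ} (hT : T.PosSemidef) : ∃ L : Matrix n n ℝ, T = L * Lᵀ := by
  obtain ⟨B, hB⟩ := CStarAlgebra.nonneg_iff_eq_star_mul_self.mp hT.nonneg
  exact ⟨Bᵀ, by rw [hB, star_eq_conjTranspose, conjTranspose_eq_transpose_of_trivial,
    transpose_transpose]⟩

theorem Matrix.posSemidef_mul_transpose_self {m n : Type*} [Finite m] [Fintype n]
    (A : Matrix m n ℝ) : (A * Aᵀ).PosSemidef := by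
  simpa using posSemidef_self_mul_conjTranspose A

theorem Matrix.posSemidef_transpose_mul_self {m n : Type*} [Finite n] [Fintype m]
    (A : Matrix m n ℝ) : (Aᵀ * A).PosSemidef := by
  simpa using posSemidef_conjTranspose_mul_self A

theorem Matrix.PosSemidef.one_add_posDef {n : Type*} [Fintype n] [DecidableEq n]
    {A : Matrix n n ℝ} (hA : A.PosSemidef) : (1 + A).PosDef :=
  PosDef.one.add_posSemidef hA

theorem Finset.one_add_sum_le_prod_one_add' {ι : Type*} (s : Finset ι) (f : ι → ℝ)
    (hf : ∀ i, 0 ≤ f i) : 1 + ∑ i ∈ s, f i ≤ ∏ i ∈ s, (1 + f i) := by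
  classical
  induction s using Finset.induction_on with
  | empty => simp
  | insert a s ha ih =>
    rw [Finset.sum_insert ha, Finset.prod_insert ha]
    nlinarith [hf a, Finset.sum_nonneg fun i (_ : i ∈ s) => hf i,
      mul_nonneg (hf a) (Finset.sum_nonneg fun i (_ : i ∈ s) => hf i),
      mul_le_mul_of_nonneg_left ih (add_nonneg zero_le_one (hf a))]

theorem Matrix.PosSemidef.one_add_trace_le_det {n : Type*} [Fintype n] [DecidableEq n]
    {M : Matrix n n ℝ} (hM : M.PosSemidef) : 1 + M.trace ≤ (1 + M).det := by
  have hdet : (1 + M).det = ∏ i, (1 + hM.1.eigenvalues i) := by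
    conv_lhs => rw [hM.1.spectral_theorem, Unitary.conjStarAlgAut_apply, mul_assoc,
      det_one_add_mul_comm, mul_assoc, Unitary.coe_star_mul_self, mul_one, ← diagonal_one,
      diagonal_add, det_diagonal]
    simp
  have htr : M.trace = ∑ i, hM.1.eigenvalues i := by
    simpa using hM.1.trace_eq_sum_eigenvalues
  rw [hdet, htr]
  exact Finset.univ.one_add_sum_le_prod_one_add' _ hM.eigenvalues_nonneg

/-- The determinant is monotone on positive definite matrices, with a trace-type gap. -/
theorem Matrix.PosDef.det_add_posSemidef {n : Type*} [Fintype n] [DecidableEq n]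
    {Q T : Matrix n n ℝ} (hQ : Q.PosDef) (hT : T.PosSemidef) :
    Q.det ≤ (Q + T).det ∧ ((Q + T).det = Q.det → T = 0) := by
  obtain ⟨L, rfl⟩ := hT.exists_eq_mul_transpose
  have hpos := hQ.det_pos
  rw [det_add_mul _ _ hpos.ne'.isUnit]
  have hG : (Lᵀ * Q⁻¹ * L).PosSemidef := by
    simpa using hQ.inv.posSemidef.conjTranspose_mul_mul_same L
  have h1 := hG.one_add_trace_le_det
  have h0 := hG.trace_nonneg
  refine ⟨by nlinarith, fun h => ?_⟩
  have hG0 : Lᵀ * Q⁻¹ * L = 0 := by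
    refine hG.trace_eq_zero_iff.mp (le_antisymm ?_ h0)
    nlinarith [mul_left_cancel₀ hpos.ne' (h.trans (mul_one _).symm)]
  obtain ⟨F, hF⟩ := hQ.inv.posSemidef.exists_eq_mul_transpose
  have hFL : Fᵀ * L = 0 := by
    rw [← conjTranspose_mul_self_eq_zero, conjTranspose_eq_transpose_of_trivial, transpose_mul,
      transpose_transpose, ← hG0, hF]
    simp only [Matrix.mul_assoc]
  have hQL : Q⁻¹ * L = 0 := by rw [hF, Matrix.mul_assoc, hFL, Matrix.mul_zero]
  have hL : L = 0 := by
    rw [← mul_nonsing_inv_cancel_left Q L hpos.ne'.isUnit, hQL, Matrix.mul_zero]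
  simp [hL]

/-- Fischer-type inequality `det (1 + A + Y Yᵀ) ≤ det (1 + A) det (1 + Y Yᵀ)`,
with equality only if `A Y = 0`. -/
theorem Matrix.PosSemidef.det_one_add_add_mul_transpose {n p : Type*} [Fintype n] [DecidableEq n]
    [Fintype p] [DecidableEq p] {A : Matrix n n ℝ} (hA : A.PosSemidef) (Y : Matrix n p ℝ) :
    (1 + A + Y * Yᵀ).det ≤ (1 + A).det * (1 + Y * Yᵀ).det ∧
      ((1 + A + Y * Yᵀ).det = (1 + A).det * (1 + Y * Yᵀ).det → A * Y = 0) := by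
  have hP := hA.one_add_posDef
  have hdet := hP.det_pos
  set J := (1 + A)⁻¹ with hJdef
  have hJ : J.PosDef := hP.inv
  have hJT : Jᵀ = J := by simpa using hJ.1.eq
  have hAT : Aᵀ = A := by simpa using hA.1.eq
  have hPJ : (1 + A) * J = 1 := mul_nonsing_inv _ hdet.ne'.isUnit
  have hJP : J * (1 + A) = 1 := nonsing_inv_mul _ hdet.ne'.isUnit
  have hAJ : A * J = 1 - J := by rw [← hPJ]; noncomm_ring
  have hJA : J * A = 1 - J := by rw [← hJP]; noncomm_ring
  have hsplit : 1 - J = J * A * J + (A * J)ᵀ * (A * J) := by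
    rw [transpose_mul, hAT, hJT, hJA, hAJ]; noncomm_ring
  set T₁ := (J * Y)ᵀ * A * (J * Y)
  set T₂ := (A * J * Y)ᵀ * (A * J * Y)
  have hT₁ : T₁.PosSemidef := by
    simpa only [conjTranspose_eq_transpose_of_trivial] using hA.conjTranspose_mul_mul_same (J * Y)
  have hT₂ : T₂.PosSemidef := posSemidef_transpose_mul_self _
  have hQ : (1 + Yᵀ * J * Y).PosDef :=
    PosSemidef.one_add_posDef (by simpa using hJ.posSemidef.conjTranspose_mul_mul_same Y)
  have hsum : 1 + Yᵀ * Y = (1 + Yᵀ * J * Y) + (T₁ + T₂) := by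
    have : Yᵀ * (1 - J) * Y = T₁ + T₂ := by
      rw [hsplit]
      simp only [T₁, T₂, transpose_mul, hJT, hAT, Matrix.mul_add, Matrix.add_mul, Matrix.mul_assoc]
    rw [← this, Matrix.mul_sub, Matrix.sub_mul, Matrix.mul_one]
    abel
  obtain ⟨hle, heq⟩ := hQ.det_add_posSemidef (hT₁.add hT₂)
  rw [det_add_mul _ _ hdet.ne'.isUnit, det_one_add_mul_comm Y, hsum]
  refine ⟨mul_le_mul_of_nonneg_left hle hdet.le, fun h => ?_⟩
  have hT := heq (mul_left_cancel₀ hdet.ne' h).symm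
  have htr : T₁.trace + T₂.trace = 0 := by rw [← trace_add, hT, trace_zero]
  have h2 : T₂ = 0 := hT₂.trace_eq_zero_iff.mp
    (by linarith [hT₁.trace_nonneg, hT₂.trace_nonneg])
  have hAJY : A * J * Y = 0 := by
    rw [← conjTranspose_mul_self_eq_zero, conjTranspose_eq_transpose_of_trivial]; exact h2
  rw [hAJ, ← hJA, Matrix.mul_assoc] at hAJY
  calc A * Y = ((1 + A) * J) * (A * Y) := by rw [hPJ, Matrix.one_mul]
    _ = 0 := by rw [Matrix.mul_assoc, hAJY, Matrix.mul_zero]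

theorem Matrix.PosSemidef.det_one_add_add {n : Type*} [Fintype n] [DecidableEq n]
    {A B : Matrix n n ℝ} (hA : A.PosSemidef) (hB : B.PosSemidef) :
    (1 + A + B).det ≤ (1 + A).det * (1 + B).det ∧
      ((1 + A + B).det = (1 + A).det * (1 + B).det → A * B = 0) := by
  obtain ⟨L, rfl⟩ := hB.exists_eq_mul_transpose
  refine (hA.det_one_add_add_mul_transpose L).imp_right fun h he => ?_
  rw [← Matrix.mul_assoc, h he, Matrix.zero_mul]

theorem Matrix.det_one_add_sum_le {n κ : Type*} [Fintype n] [DecidableEq n] [DecidableEq κ]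
    {A : κ → Matrix n n ℝ} (hA : ∀ k, (A k).PosSemidef) {B : Matrix n n ℝ} (hB : B.PosSemidef)
    (s : Finset κ) :
    (1 + B + ∑ k ∈ s, A k).det ≤ (1 + B).det * ∏ k ∈ s, (1 + A k).det := by
  induction s using Finset.induction_on with
  | empty => simp
  | insert a s ha ih =>
    have hS : (B + ∑ k ∈ s, A k).PosSemidef := hB.add (posSemidef_sum s fun k _ => hA k)
    have h := (hS.det_one_add_add (hA a)).1
    have h' := mul_le_mul_of_nonneg_right ih (hA a).one_add_posDef.det_pos.le
    rw [Finset.sum_insert ha, Finset.prod_insert ha]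
    calc _ = (1 + (B + ∑ k ∈ s, A k) + A a).det := by congr 1; abel
      _ ≤ _ := h
      _ ≤ (1 + B).det * (∏ k ∈ s, (1 + A k).det) * (1 + A a).det := by
        rw [← add_assoc]; exact h'
      _ = _ := by ring

theorem Matrix.mul_eq_zero_of_det_one_add_sum {n κ : Type*} [Fintype n] [DecidableEq n]
    [DecidableEq κ] [Fintype κ] {A : κ → Matrix n n ℝ} (hA : ∀ k, (A k).PosSemidef)
    (h : (1 + ∑ k, A k).det = ∏ k, (1 + A k).det) {k l : κ} (hkl : k ≠ l) : A k * A l = 0 := by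
  have hl : l ∈ Finset.univ.erase k := by simp [hkl.symm]
  set s := (Finset.univ.erase k).erase l
  have hsum : 1 + ∑ k, A k = 1 + (A k + A l) + ∑ j ∈ s, A j := by
    rw [← Finset.add_sum_erase _ A (Finset.mem_univ k), ← Finset.add_sum_erase _ A hl]
    abel
  have hprod : ∏ j, (1 + A j).det =
      (1 + A k).det * (1 + A l).det * ∏ j ∈ s, (1 + A j).det := by
    rw [← Finset.mul_prod_erase _ _ (Finset.mem_univ k), ← Finset.mul_prod_erase _ _ hl, mul_assoc]
  have hpos : 0 < ∏ j ∈ s, (1 + A j).det :=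
    Finset.prod_pos fun j _ => (hA j).one_add_posDef.det_pos
  obtain ⟨hle, heq⟩ := (hA k).det_one_add_add (hA l)
  refine heq (le_antisymm hle (le_of_mul_le_mul_right ?_ hpos))
  rw [← hprod, ← h, hsum, add_assoc 1 (A k)]
  exact det_one_add_sum_le hA ((hA k).add (hA l)) s

theorem Matrix.det_one_add_sum_of_mul_eq_zero {n κ : Type*} [Fintype n] [DecidableEq n]
    [DecidableEq κ] {A : κ → Matrix n n ℝ} (hA : ∀ k l, k ≠ l → A k * A l = 0) (s : Finset κ) :
    (1 + ∑ k ∈ s, A k).det = ∏ k ∈ s, (1 + A k).det := by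
  induction s using Finset.induction_on with
  | empty => simp
  | insert a s ha ih =>
    have h0 : A a * ∑ k ∈ s, A k = 0 := by
      rw [Matrix.mul_sum]
      exact Finset.sum_eq_zero fun k hk => hA a k fun h => ha (h ▸ hk)
    rw [Finset.sum_insert ha, Finset.prod_insert ha, ← ih, ← det_mul, Matrix.add_mul,
      Matrix.mul_add (A a), h0]
    simp only [Matrix.one_mul, Matrix.mul_one, add_zero]
    congr 1
    abel

/-- The orthogonal projection onto the column space of `Z`, in factored form. -/
theorem Matrix.exists_mul_transpose_mul_eq_self {d : ℕ} {n : Type*} [Fintype n] [DecidableEq n]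
    (Z : Matrix (Fin d) n ℝ) : ∃ B : Matrix (Fin d) (Fin Z.rank) ℝ, B * Bᵀ * Z = Z := by
  let f := toLin (Pi.basisFun ℝ n) (EuclideanSpace.basisFun (Fin d) ℝ).toBasis Z
  have hr : Module.finrank ℝ (LinearMap.range f) = Z.rank :=
    (rank_eq_finrank_range_toLin Z _ _).symm
  let b := (stdOrthonormalBasis ℝ (LinearMap.range f)).reindex (finCongr hr)
  refine ⟨of fun r j => (b j : EuclideanSpace ℝ (Fin d)) r, ?_⟩
  ext r c
  let v : LinearMap.range f := ⟨f (Pi.single c 1), LinearMap.mem_range_self _ _⟩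
  have hv : ∀ s, (v : EuclideanSpace ℝ (Fin d)) s = Z s c := by
    intro s
    have hr : (Pi.basisFun ℝ n).repr (Pi.single c 1) = Finsupp.single c 1 := by
      rw [← Pi.basisFun_apply, Module.Basis.repr_self]
    simp [v, f, toLin_apply, hr, Finsupp.single_eq_pi_single, Pi.single_apply]
  have h := congrArg (fun w : LinearMap.range f => (w : EuclideanSpace ℝ (Fin d)) r) (b.sum_repr' v)
  simp only [hv, Submodule.coe_sum, Submodule.coe_smul, Submodule.coe_inner, PiLp.inner_apply,
    WithLp.ofLp_sum, WithLp.ofLp_smul, Finset.sum_apply, Pi.smul_apply, smul_eq_mul] at h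
  rw [← h, Matrix.mul_assoc, Matrix.mul_apply]
  refine Finset.sum_congr rfl fun j _ => ?_
  rw [Matrix.mul_apply, mul_comm]
  simp [mul_comm]

/-- Class-wise maps that act isometrically on the column space of `Z k` and send different
classes to orthogonal subspaces. -/
theorem exists_orthogonal_class_maps {d : ℕ} {κ : Type*} [Fintype κ] {n : κ → Type*}
    [∀ k, Fintype (n k)] [∀ k, DecidableEq (n k)] (Z : ∀ k, Matrix (Fin d) (n k) ℝ)
    (h : ∑ k, (Z k).rank ≤ d) :
    ∃ W : κ → Matrix (Fin d) (Fin d) ℝ,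
      (∀ k, (W k)ᵀ * W k * Z k = Z k) ∧ ∀ k l, k ≠ l → (W k)ᵀ * W l = 0 := by
  choose B hB using fun k => (Z k).exists_mul_transpose_mul_eq_self
  obtain ⟨σ⟩ : Nonempty (((k : κ) × Fin (Z k).rank) ↪ Fin d) :=
    Function.Embedding.nonempty_of_card_le (by simpa using h)
  let E : ∀ k, Matrix (Fin d) (Fin (Z k).rank) ℝ :=
    fun k => (1 : Matrix (Fin d) (Fin d) ℝ).submatrix id fun j => σ ⟨k, j⟩
  have hE : ∀ k l, (E k)ᵀ * E l =
      (1 : Matrix (Fin d) (Fin d) ℝ).submatrix (fun j => σ ⟨k, j⟩) fun j => σ ⟨l, j⟩ := by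
    intro k l
    ext i j
    simp [E, Matrix.mul_apply, Matrix.one_apply]
  refine ⟨fun k => E k * (B k)ᵀ, fun k => ?_, fun k l hkl => ?_⟩
  · have hE1 : (E k)ᵀ * E k = 1 := by
      rw [hE]
      exact Matrix.submatrix_one _ fun i j hij => by simpa using σ.injective hij
    rw [Matrix.transpose_mul, Matrix.transpose_transpose, Matrix.mul_assoc (B k),
      ← Matrix.mul_assoc (E k)ᵀ, hE1, Matrix.one_mul, hB]
  · have hE0 : (E k)ᵀ * E l = 0 := by
      rw [hE]
      ext i j
      have : σ ⟨k, i⟩ ≠ σ ⟨l, j⟩ := fun h => hkl (congrArg Sigma.fst (σ.injective h))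
      simp [this]
    rw [Matrix.transpose_mul, Matrix.transpose_transpose, Matrix.mul_assoc (B k),
      ← Matrix.mul_assoc (E k)ᵀ, hE0, Matrix.zero_mul, Matrix.mul_zero]

theorem classConcat_mul {d : ℕ} {ι : Type*} {mk : ι → ℕ} (W : Matrix (Fin d) (Fin d) ℝ)
    (Z : ∀ i, Matrix (Fin d) (Fin (mk i)) ℝ) :
    classConcat (fun i => W * Z i) = W * classConcat Z := rfl

theorem mul_eq_self_of_mul_classConcat {d : ℕ} {ι : Type*} {mk : ι → ℕ}
    {P : Matrix (Fin d) (Fin d) ℝ} {Z : ∀ i, Matrix (Fin d) (Fin (mk i)) ℝ}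
    (h : P * classConcat Z = classConcat Z) (i : ι) : P * Z i = Z i := by
  ext r c
  exact congrFun (congrFun h r) ⟨i, c⟩

theorem Matrix.transpose_mul_eq_zero_of_gram {d p q : Type*} [Fintype d] [Fintype p] [Fintype q]
    {X : Matrix d p ℝ} {Y : Matrix d q ℝ} (h : (X * Xᵀ) * (Y * Yᵀ) = 0) : Xᵀ * Y = 0 := by
  have h1 : Xᵀ * (Y * Yᵀ) = 0 := by
    have := (self_mul_conjTranspose_mul_eq_zero X (Y * Yᵀ)).mp (by simpa using h)
    simpa using this
  have := (mul_self_mul_conjTranspose_eq_zero Y Xᵀ).mp (by simpa using h1)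
  simpa using this

/-- Rotating the classes onto mutually orthogonal subspaces keeps the Gram matrices of the blocks,
keeps feasibility, and separates the classes. -/
theorem mcr2Feasible.exists_orthogonal {d N K : ℕ} {G : SimpleGraph (Fin N)} {dk : Fin K → ℕ}
    {m : Fin N → Fin K → ℕ} {Z : ∀ i k, Matrix (Fin d) (Fin (m i k)) ℝ}
    (hZ : mcr2Feasible G dk m Z) (hd : ∑ k, dk k ≤ d) :
    ∃ Z' : ∀ i k, Matrix (Fin d) (Fin (m i k)) ℝ, mcr2Feasible G dk m Z' ∧
      (∀ i k, (Z' i k)ᵀ * Z' i k = (Z i k)ᵀ * Z i k) ∧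
      ∀ i k l, k ≠ l → (Z' i k)ᵀ * Z' i l = 0 := by
  obtain ⟨htr, hcons, hrank⟩ := hZ
  obtain ⟨W, hW, hW0⟩ := exists_orthogonal_class_maps (fun k => classConcat fun i => Z i k)
    ((Finset.sum_le_sum fun k _ => hrank k).trans hd)
  have hgram : ∀ i k, (W k * Z i k)ᵀ * (W k * Z i k) = (Z i k)ᵀ * Z i k := by
    intro i k
    have h := mul_eq_self_of_mul_classConcat (hW k) i
    rw [Matrix.mul_assoc] at h
    rw [Matrix.transpose_mul, Matrix.mul_assoc, h]
  refine ⟨fun i k => W k * Z i k, ⟨fun i k => by rw [hgram, htr], fun i j hij k => ?_,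
    fun k => ?_⟩, hgram, fun i k l hkl => ?_⟩
  · have h : ∀ i, (1 / (m i k : ℝ)) • (W k * Z i k * (W k * Z i k)ᵀ) =
        W k * ((1 / (m i k : ℝ)) • (Z i k * (Z i k)ᵀ)) * (W k)ᵀ := by
      intro i
      simp only [Matrix.transpose_mul, Matrix.mul_smul, Matrix.smul_mul, Matrix.mul_assoc]
    rw [h, h, hcons i j hij k]
  · rw [classConcat_mul]
    exact (Matrix.rank_mul_le_right _ _).trans (hrank k)
  · rw [Matrix.transpose_mul, Matrix.mul_assoc, ← Matrix.mul_assoc (W k)ᵀ, hW0 k l hkl,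
      Matrix.zero_mul, Matrix.mul_zero]

theorem mcr2Feasible.gram_eq_smul {d N K : ℕ} {G : SimpleGraph (Fin N)} {dk : Fin K → ℕ}
    {m : Fin N → Fin K → ℕ} {Z : ∀ i k, Matrix (Fin d) (Fin (m i k)) ℝ}
    (hZ : mcr2Feasible G dk m Z) (hG : G.Connected) (i j : Fin N) (k : Fin K) :
    (1 / (m i k : ℝ)) • (Z i k * (Z i k)ᵀ) = (1 / (m j k : ℝ)) • (Z j k * (Z j k)ᵀ) := by
  obtain ⟨w⟩ := hG.preconnected i j
  induction w with
  | nil => rfl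
  | cons hadj _ ih => exact (hZ.2.1 _ _ hadj k).trans ih

theorem Matrix.det_one_add_smul_mul_transpose_congr {n p : Type*} [Fintype n] [DecidableEq n]
    [Fintype p] [DecidableEq p] {X Y : Matrix n p ℝ} (h : Xᵀ * X = Yᵀ * Y) (c : ℝ) :
    (1 + c • (X * Xᵀ)).det = (1 + c • (Y * Yᵀ)).det := by
  rw [← Matrix.smul_mul, ← Matrix.smul_mul, det_one_add_mul_comm, det_one_add_mul_comm (c • Y),
    Matrix.mul_smul, Matrix.mul_smul, h]

/-- Theorem 1, properties 1 and 2: under a connected communication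
graph, ambient dimension `d ≥ Σ_k d_k`, high coding precision
`ε⁴ < min_k (m_k/m)(d/d_k)²`, and equal class proportions (Assumption 1), any optimal
solution of the distributed MCR² problem (6) has mutually orthogonal class subspaces,
both within each node and across nodes. -/
theorem mcr2_optimal_between_class_orthogonality
    (d N K : ℕ) (hN : 1 ≤ N) (hK : 1 ≤ K)
    (G : SimpleGraph (Fin N)) (hG : G.Connected)
    (dk : Fin K → ℕ) (m : Fin N → Fin K → ℕ) (hm : ∀ i k, 0 < m i k)
    (ε : ℝ) (hε : 0 < ε)
    (hd : ∑ k, dk k ≤ d)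
    (hε4 : ∀ k, ε ^ 4 <
      ((∑ i, (m i k : ℝ)) / (∑ i, ∑ l, (m i l : ℝ))) * ((d : ℝ) / (dk k : ℝ)) ^ 2)
    (hA1 : ∀ i j k,
      (m i k : ℝ) / (∑ l, (m i l : ℝ)) = (m j k : ℝ) / (∑ l, (m j l : ℝ)))
    (Zstar : ∀ i k, Matrix (Fin d) (Fin (m i k)) ℝ)
    (hfeas : mcr2Feasible G dk m Zstar)
    (hopt : ∀ Z : ∀ i k, Matrix (Fin d) (Fin (m i k)) ℝ,
      mcr2Feasible G dk m Z → mcr2Objective ε m Z ≤ mcr2Objective ε m Zstar) :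
    (∀ i : Fin N, ∀ k1 k2 : Fin K, k1 ≠ k2 → (Zstar i k1)ᵀ * Zstar i k2 = 0) ∧
    (∀ i j : Fin N, ∀ k1 k2 : Fin K, k1 ≠ k2 → (Zstar i k1)ᵀ * Zstar j k2 = 0) := by
  have hd0 : 0 < d := by
    rcases Nat.eq_zero_or_pos d with rfl | h
    · have := hfeas.1 ⟨0, hN⟩ ⟨0, hK⟩
      simp [Matrix.trace] at this
      exact absurd this.symm (Nat.cast_pos.mpr (hm _ _)).ne'
    · exact h
  have hmi : ∀ i, 0 < ∑ k, (m i k : ℝ) := fun i =>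
    Finset.sum_pos (fun k _ => Nat.cast_pos.mpr (hm i k)) ⟨⟨0, hK⟩, Finset.mem_univ _⟩
  have hM : 0 < ∑ i, ∑ k, (m i k : ℝ) :=
    Finset.sum_pos (fun i _ => hmi i) ⟨⟨0, hN⟩, Finset.mem_univ _⟩
  obtain ⟨Z', hZ', hgram, horth⟩ := hfeas.exists_orthogonal hd
  set c : Fin N → ℝ := fun i => (d : ℝ) / ((∑ k, (m i k : ℝ)) * ε ^ 2) with hc
  have hc0 : ∀ i, 0 < c i := fun i =>
    div_pos (Nat.cast_pos.mpr hd0) (mul_pos (hmi i) (pow_pos hε 2))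
  let A : Fin N → Fin K → Matrix (Fin d) (Fin d) ℝ :=
    fun i k => c i • (Zstar i k * (Zstar i k)ᵀ)
  have hA : ∀ i k, (A i k).PosSemidef := fun i k =>
    (Matrix.posSemidef_mul_transpose_self _).smul (hc0 i).le
  have hle : ∀ i, (1 + ∑ k, A i k).det ≤ ∏ k, (1 + A i k).det := fun i => by
    simpa using Matrix.det_one_add_sum_le (hA i) Matrix.PosSemidef.zero Finset.univ
  have hpos : ∀ i, 0 < (1 + ∑ k, A i k).det := fun i =>
    (Matrix.posSemidef_sum _ fun k _ => hA i k).one_add_posDef.det_pos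
  have hdet' : ∀ i, (1 + c i • ∑ k, Z' i k * (Z' i k)ᵀ).det = ∏ k, (1 + A i k).det := by
    intro i
    rw [Finset.smul_sum, Matrix.det_one_add_sum_of_mul_eq_zero]
    · exact Finset.prod_congr rfl fun k _ =>
        Matrix.det_one_add_smul_mul_transpose_congr (hgram i k) _
    · intro k l hkl
      rw [Matrix.smul_mul, Matrix.mul_smul, Matrix.mul_assoc, ← Matrix.mul_assoc (Z' i k)ᵀ,
        horth i k l hkl, Matrix.zero_mul, Matrix.mul_zero, smul_zero, smul_zero]
  let w : Fin N → ℝ := fun i => (∑ k, (m i k : ℝ)) / (2 * ∑ i', ∑ k, (m i' k : ℝ))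
  have hw : ∀ i, 0 < w i := fun i => div_pos (hmi i) (mul_pos two_pos hM)
  have hterm : ∀ i ∈ Finset.univ, w i * Real.log (1 + ∑ k, A i k).det ≤
      w i * Real.log (∏ k, (1 + A i k).det) := fun i _ =>
    mul_le_mul_of_nonneg_left (Real.log_le_log (hpos i) (hle i)) (hw i).le
  have hobj : ∑ i, w i * Real.log (∏ k, (1 + A i k).det) ≤
      ∑ i, w i * Real.log (1 + ∑ k, A i k).det := by
    have h := hopt Z' hZ'
    simp only [mcr2Objective, Finset.sum_sub_distrib] at h
    simp only [Matrix.det_one_add_smul_mul_transpose_congr (hgram _ _)] at h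
    have h' := sub_le_sub_iff_right _ |>.mp h
    change ∑ i, w i * Real.log (1 + c i • ∑ k, Z' i k * (Z' i k)ᵀ).det ≤
      ∑ i, w i * Real.log (1 + c i • ∑ k, Zstar i k * (Zstar i k)ᵀ).det at h'
    simp only [hdet'] at h'
    simpa only [A, Finset.smul_sum] using h'
  have hdet : ∀ i, (1 + ∑ k, A i k).det = ∏ k, (1 + A i k).det := by
    intro i
    have h := (Finset.sum_eq_sum_iff_of_le hterm).mp
      (le_antisymm (Finset.sum_le_sum hterm) hobj) i (Finset.mem_univ i)
    exact Real.log_injOn_pos (hpos i) ((hpos i).trans_le (hle i))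
      (mul_left_cancel₀ (hw i).ne' h)
  have hwithin : ∀ i k l, k ≠ l → (Zstar i k * (Zstar i k)ᵀ) * (Zstar i l * (Zstar i l)ᵀ) = 0 := by
    intro i k l hkl
    have h := Matrix.mul_eq_zero_of_det_one_add_sum (hA i) (hdet i) hkl
    simpa [A, (hc0 i).ne'] using h
  have hacross : ∀ i j k l, k ≠ l → (Zstar i k)ᵀ * Zstar j l = 0 := by
    intro i j k l hkl
    apply Matrix.transpose_mul_eq_zero_of_gram
    have hj : (m j l : ℝ) ≠ 0 := Nat.cast_ne_zero.mpr (hm j l).ne'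
    have h := congrArg (fun M => (m j l : ℝ) • M) (hfeas.gram_eq_smul hG j i l)
    simp only [smul_smul, mul_one_div_cancel hj, one_smul] at h
    rw [h, Matrix.mul_smul, hwithin i k l hkl, smul_zero]
  exact ⟨fun i => hacross i i, hacross⟩

end
end

section
/- Let S ≥ 1 be a number of clusters and K ≥ 1 a number of classes. For each cluster s and class k let Ṽ_k^s be a finite set of (virtual) node indices; for each node i let S_i ≥ 1 be its replication count, K_i its set of classes, Z_{i,k} ∈ ℝ^{d × m_{i,k}} its class-k feature matrix (m_{i,k} a positive integer), and suppose Z_i Z_iᵀ = Σ_{k∈K_i} Z_{i,k} Z_{i,k}ᵀ. Define m_k^s = Σ_{i∈Ṽ_k^s} m_{i,k}/S_i and m^s = Σ_{k=1}^K m_k^s, assuming each m^s > 0. Assume: (a) class-wise consensus — for each class k there is a positive semidefinite d × d matrix W_k with (1/m_{i,k})·Z_{i,k} Z_{i,k}ᵀ = W_k for every node i holding class k; and (b) Assumption 4 — m_k^s/m^s = m_k^{s'}/m^{s'} for all clusters s, s' and every class k. Then the normalized cluster covariances are all equal: (1/m^s)·Σ_{i∈Ṽ^s} (1/S_i)·Z_i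 Z_iᵀ = (1/m^{s'})·Σ_{i∈Ṽ^{s'}} (1/S_i)·Z_i Z_iᵀ for all clusters s, s', where Ṽ^s = ∪_k Ṽ_k^s. (This is the key step in the proof of Theorem 3, ensuring that equality holds in the clustered Jensen bound (12).) -/
open Matrix BigOperators

/-- key step of the proof of Theorem 3: class-wise variance consensus
(`(1/m_{i,k}) Z_{i,k} Z_{i,k}ᵀ = W_k` with `W_k` PSD, for every node holding class `k`)
together with Assumption 4 (`m_k^s/m^s = m_k^{s'}/m^{s'}`) implies that the normalized
cluster covariances `(1/m^s) Σ_{i∈Ṽ^s} (1/S_i) Z_i Z_iᵀ` are equal across all clusters,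
where `Ṽ^s = ∪_k Ṽ_k^s`, `Z_i Z_iᵀ = Σ_{k∈K_i} Z_{i,k} Z_{i,k}ᵀ`,
`m_k^s = Σ_{i∈Ṽ_k^s} m_{i,k}/S_i` and `m^s = Σ_k m_k^s > 0`. -/
theorem clustered_consensus_equal_normalized_covariances
    (d S K : ℕ) (hS : 1 ≤ S) (hK : 1 ≤ K)
    {ι : Type*} [Fintype ι] [DecidableEq ι]
    (Vk : Fin S → Fin K → Finset ι)
    (Si : ι → ℕ) (hSi : ∀ i, 1 ≤ Si i)
    (Ki : ι → Finset (Fin K))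
    (m : ι → Fin K → ℕ) (hm : ∀ i : ι, ∀ k ∈ Ki i, 0 < m i k)
    (Z : ∀ (i : ι) (k : Fin K), Matrix (Fin d) (Fin (m i k)) ℝ)
    (GramI : ι → Matrix (Fin d) (Fin d) ℝ)
    (hGram : ∀ i, GramI i = ∑ k ∈ Ki i, Z i k * (Z i k)ᵀ)
    (hVK : ∀ s k (i : ι),
      i ∈ Vk s k ↔ (i ∈ Finset.univ.biUnion (Vk s) ∧ k ∈ Ki i))
    (hms : ∀ s, 0 < ∑ k, ∑ i ∈ Vk s k, (m i k : ℝ) / (Si i : ℝ))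
    (W : Fin K → Matrix (Fin d) (Fin d) ℝ) (hW : ∀ k, (W k).PosSemidef)
    (hcons : ∀ (k : Fin K) (i : ι), (∃ s, i ∈ Vk s k) →
      (1 / (m i k : ℝ)) • (Z i k * (Z i k)ᵀ) = W k)
    (hA4 : ∀ s s' k,
      (∑ i ∈ Vk s k, (m i k : ℝ) / (Si i : ℝ)) /
          (∑ l, ∑ i ∈ Vk s l, (m i l : ℝ) / (Si i : ℝ))
        = (∑ i ∈ Vk s' k, (m i k : ℝ) / (Si i : ℝ)) /
          (∑ l, ∑ i ∈ Vk s' l, (m i l : ℝ) / (Si i : ℝ))) :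
    ∀ s s' : Fin S,
      (∑ l, ∑ i ∈ Vk s l, (m i l : ℝ) / (Si i : ℝ))⁻¹ •
          ∑ i ∈ Finset.univ.biUnion (Vk s), ((Si i : ℝ)⁻¹) • GramI i
        = (∑ l, ∑ i ∈ Vk s' l, (m i l : ℝ) / (Si i : ℝ))⁻¹ •
          ∑ i ∈ Finset.univ.biUnion (Vk s'), ((Si i : ℝ)⁻¹) • GramI i := by
  have expand : ∀ s : Fin S,
      (∑ l, ∑ i ∈ Vk s l, (m i l : ℝ) / (Si i : ℝ))⁻¹ •
          ∑ i ∈ Finset.univ.biUnion (Vk s), ((Si i : ℝ)⁻¹) • GramI i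
        = ∑ k, ((∑ i ∈ Vk s k, (m i k : ℝ) / (Si i : ℝ)) /
            (∑ l, ∑ i ∈ Vk s l, (m i l : ℝ) / (Si i : ℝ))) • W k := by
    intro s
    have swap : ∑ i ∈ Finset.univ.biUnion (Vk s), ((Si i : ℝ)⁻¹) • GramI i
        = ∑ k, ∑ i ∈ Vk s k, ((Si i : ℝ)⁻¹) • (Z i k * (Z i k)ᵀ) := by
      simp_rw [hGram, Finset.smul_sum]
      refine Finset.sum_comm' fun i k => ?_
      rw [hVK s k i]
      simp
    rw [swap, Finset.smul_sum]
    refine Finset.sum_congr rfl fun k _ => ?_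
    rw [div_eq_inv_mul, mul_smul, Finset.sum_smul]
    congr 1
    refine Finset.sum_congr rfl fun i hi => ?_
    have hmik : (m i k : ℝ) ≠ 0 := by
      exact_mod_cast (hm i k ((hVK s k i).1 hi).2).ne'
    rw [← hcons k i ⟨s, hi⟩, smul_smul]
    congr 1
    field_simp
  intro s s'
  rw [expand s, expand s']
  exact Finset.sum_congr rfl fun k _ => by rw [hA4 s s' k]
end
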